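/- arXiv:2303.10281 — 6 statements merged into one kernel-verified Lean document; each statement's English description precedes it below -/
import Mathlib

section
/- Let n ≥ 4 be an even integer. Then the set S = {λ : ℝ | ∃ p : ZMod n → ℂ, ∀ j, 1 ≤ ‖p j‖ ∧ ‖p j‖ ≤ λ ∧ 1 ≤ ‖p j - p (j-1)‖ ∧ ‖p j - p (j-1)‖ ≤ λ} has least element 1. (Equivalently, the complex flow number of the wheel graph W_n equals 2 for even n.) -/
open Real

/-- A point of the unit circle at distance one from `1`. -/
lemma exists_norm_eq_one_norm_sub_one_eq_one : ∃ w : ℂ, ‖w‖ = 1 ∧ ‖w - 1‖ = 1 := by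
  have h : √3 * √3 = 3 := Real.mul_self_sqrt (by norm_num)
  refine ⟨⟨1 / 2, √3 / 2⟩, ?_, ?_⟩ <;>
  · rw [Complex.norm_def, Real.sqrt_eq_one, Complex.normSq_apply]
    norm_num
    linarith

theorem wheel_even_least (n : ℕ) (hn : 4 ≤ n) (heven : Even n) :
    IsLeast {l : ℝ | ∃ p : ZMod n → ℂ, ∀ j : ZMod n,
      1 ≤ ‖p j‖ ∧ ‖p j‖ ≤ l ∧ 1 ≤ ‖p j - p (j - 1)‖ ∧ ‖p j - p (j - 1)‖ ≤ l} 1 := by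
  refine ⟨?_, fun l ⟨p, hp⟩ => (hp 0).1.trans (hp 0).2.1⟩
  obtain ⟨w, hw, hw'⟩ := exists_norm_eq_one_norm_sub_one_eq_one
  let c : ZMod n →+* ZMod 2 := ZMod.castHom heven.two_dvd (ZMod 2)
  refine ⟨fun j => if c j = 0 then 1 else w, fun j => ?_⟩
  have h01 : c j = 0 ∨ c j = 1 := by
    generalize c j = x
    revert x
    decide
  rcases h01 with h | h <;> simp [h, hw, hw', norm_sub_rev 1 w]
end

section
/- Let n ≥ 7 be an integer with n ≡ 1 (mod 6). Then the set S = {λ : ℝ | ∃ p : ZMod n → ℂ, ∀ j, 1 ≤ ‖p j‖ ∧ ‖p j‖ ≤ λ ∧ 1 ≤ ‖p j - p (j-1)‖ ∧ ‖p j - p (j-1)‖ ≤ λ} has least element 2·sin((π/6)·(n/(n-1))). (Equivalently, φ_ℂ(W_n) = 1 + 2·sin((π/6)·(n/(n-1))) for n ≡ 1 mod 6.) -/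
open Real

lemma sin_sq_sum_sub_one_le {x y : ℝ} (hx : 0 ≤ x) (hx' : x ≤ π / 12) (hy : 0 ≤ y)
    (hy' : y ≤ π / 12) :
    4 * sin (π / 6 + x) ^ 2 + 4 * sin (π / 6 + y) ^ 2 - 1 ≤
      8 * sin (π / 6 + x) * sin (π / 6 + y) * cos (π / 3 - x - y) := by
  have hpi := Real.pi_pos
  have h1 : 0 ≤ cos (x + y) := cos_nonneg_of_mem_Icc ⟨by linarith, by linarith⟩
  have h2 : 0 ≤ sin x := sin_nonneg_of_nonneg_of_le_pi hx (by linarith)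
  have h3 : 0 ≤ sin y := sin_nonneg_of_nonneg_of_le_pi hy (by linarith)
  have h4 : 0 ≤ cos (x + y) * (sin x * sin y) := by positivity
  have e1 : 2 * sin (π / 6 + x) * sin (π / 6 + y) = cos (x - y) - cos (π / 3 + (x + y)) := by
    rw [show x - y = (π / 6 + x) - (π / 6 + y) by ring,
      show π / 3 + (x + y) = (π / 6 + x) + (π / 6 + y) by ring, cos_add, cos_sub]
    ring
  have e2 : sin (π / 6 + x) ^ 2 + sin (π / 6 + y) ^ 2 =
      1 - cos (π / 3 + (x + y)) * cos (x - y) := by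
    rw [show x - y = (π / 6 + x) - (π / 6 + y) by ring,
      show π / 3 + (x + y) = (π / 6 + x) + (π / 6 + y) by ring, cos_sub, cos_add]
    linear_combination (1 - sin (π / 6 + y) ^ 2) * sin_sq_add_cos_sq (π / 6 + x) +
      (cos (π / 6 + x) ^ 2) * sin_sq_add_cos_sq (π / 6 + y)
  have e3 : cos (π / 3 + (x + y)) = cos (x + y) / 2 - √3 / 2 * sin (x + y) := by
    rw [cos_add, cos_pi_div_three, sin_pi_div_three]; ring
  have e4 : cos (π / 3 - x - y) = cos (x + y) / 2 + √3 / 2 * sin (x + y) := by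
    rw [sub_sub, cos_sub, cos_pi_div_three, sin_pi_div_three]; ring
  have e5 : 2 * (sin x * sin y) = cos (x - y) - cos (x + y) := by
    rw [cos_sub, cos_add]; ring
  have s3 : √3 ^ 2 = 3 := Real.sq_sqrt (by norm_num)
  have key : 8 * sin (π / 6 + x) * sin (π / 6 + y) * cos (π / 3 - x - y) -
      (4 * sin (π / 6 + x) ^ 2 + 4 * sin (π / 6 + y) ^ 2 - 1) =
      8 * (cos (x + y) * (sin x * sin y)) := by
    have : 8 * sin (π / 6 + x) * sin (π / 6 + y) * cos (π / 3 - x - y) =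
        4 * (cos (x - y) - cos (π / 3 + (x + y))) * cos (π / 3 - x - y) := by
      rw [← e1]; ring
    rw [this, show 8 * (cos (x + y) * (sin x * sin y)) =
      4 * cos (x + y) * (2 * (sin x * sin y)) by ring, e5, e4]
    rw [e3] at e2 ⊢
    linear_combination (-4) * e2 + sin (x + y) ^ 2 * s3 + 3 * sin_sq_add_cos_sq (x + y)
  linarith

lemma le_sin_sq_sum_sub_sin_sq {x y e : ℝ} (hx : 0 ≤ x) (hxe : x ≤ e) (hy : 0 ≤ y)
    (hye : y ≤ e) (he : e ≤ π / 12) :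
    8 * sin (π / 6 + x) * sin (π / 6 + y) * cos (π / 3 + 2 * e - x - y) ≤
      4 * sin (π / 6 + x) ^ 2 + 4 * sin (π / 6 + y) ^ 2 - 4 * sin (π / 6 + e) ^ 2 := by
  have hpi := Real.pi_pos
  have e1 : 2 * sin (π / 6 + x) * sin (π / 6 + y) =
      cos (x - y) - cos ((π / 3 + e) + (x + y - e)) := by
    rw [show x - y = (π / 6 + x) - (π / 6 + y) by ring,
      show (π / 3 + e) + (x + y - e) = (π / 6 + x) + (π / 6 + y) by ring, cos_add, cos_sub]
    ring
  have e2 : sin (π / 6 + x) ^ 2 + sin (π / 6 + y) ^ 2 =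
      1 - cos ((π / 3 + e) + (x + y - e)) * cos (x - y) := by
    rw [show x - y = (π / 6 + x) - (π / 6 + y) by ring,
      show (π / 3 + e) + (x + y - e) = (π / 6 + x) + (π / 6 + y) by ring, cos_sub, cos_add]
    linear_combination (1 - sin (π / 6 + y) ^ 2) * sin_sq_add_cos_sq (π / 6 + x) +
      (cos (π / 6 + x) ^ 2) * sin_sq_add_cos_sq (π / 6 + y)
  have e3 : sin (π / 6 + e) = cos e - cos (π / 3 + e) := by
    rw [sin_add, cos_add, cos_pi_div_three, sin_pi_div_three, cos_pi_div_six, sin_pi_div_six]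
    ring
  have e4 : π / 3 + 2 * e - x - y = (π / 3 + e) - (x + y - e) := by ring
  have c1 : cos e ≤ cos (x + y - e) := by
    rw [← cos_abs (x + y - e)]
    exact cos_le_cos_of_nonneg_of_le_pi (abs_nonneg _) (by linarith)
      (abs_le.2 ⟨by linarith, by linarith⟩)
  have c2 : cos (π / 3 + e) ≤ cos e :=
    cos_le_cos_of_nonneg_of_le_pi (by linarith) (by linarith) (by linarith)
  have c3 : 0 ≤ cos (π / 3 + e) := cos_nonneg_of_mem_Icc ⟨by linarith, by linarith⟩
  have c4 : cos (x - y) ≤ 1 := cos_le_one _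
  have key : 4 * sin (π / 6 + x) ^ 2 + 4 * sin (π / 6 + y) ^ 2 - 4 * sin (π / 6 + e) ^ 2 -
      8 * sin (π / 6 + x) * sin (π / 6 + y) * cos (π / 3 + 2 * e - x - y) =
      4 * (cos (π / 3 + e) ^ 2 + cos (x + y - e) ^ 2 -
        2 * cos (x - y) * cos (π / 3 + e) * cos (x + y - e) - (cos e - cos (π / 3 + e)) ^ 2) := by
    have : 8 * sin (π / 6 + x) * sin (π / 6 + y) * cos (π / 3 + 2 * e - x - y) =
        4 * (cos (x - y) - cos ((π / 3 + e) + (x + y - e))) * cos (π / 3 + 2 * e - x - y) := by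
      rw [← e1]; ring
    rw [this, e3, e4, cos_sub (π / 3 + e) (x + y - e)]
    rw [cos_add (π / 3 + e) (x + y - e)] at e2 ⊢
    linear_combination 4 * e2 - 4 * (sin (x + y - e) ^ 2) * sin_sq_add_cos_sq (π / 3 + e) -
      4 * (1 - cos (π / 3 + e) ^ 2) * sin_sq_add_cos_sq (x + y - e)
  have h1 : 0 ≤ (1 - cos (x - y)) * (cos (π / 3 + e) * cos (x + y - e)) :=
    mul_nonneg (by linarith) (mul_nonneg c3 (by linarith))
  nlinarith [mul_nonneg (sub_nonneg.2 c1)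
    (show 0 ≤ cos (x + y - e) + cos e - 2 * cos (π / 3 + e) by linarith)]

/-- If a triangle has sides in `[1, 2 sin (π / 6 + e)]`, its angle `β` between the sides
`2 sin (π / 6 + x)` and `2 sin (π / 6 + y)` deviates from `π / 3` by a controlled amount. -/
lemma triangle_angle_bounds {x y e c β : ℝ} (hx : 0 ≤ x) (hxe : x ≤ e) (hy : 0 ≤ y)
    (hye : y ≤ e) (he : e ≤ π / 12) (hβ : 0 ≤ β) (hβ' : β ≤ π)
    (hc : 1 ≤ c) (hc' : c ≤ 2 * sin (π / 6 + e))
    (hcos : c ^ 2 = (2 * sin (π / 6 + x)) ^ 2 + (2 * sin (π / 6 + y)) ^ 2 -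
      2 * (2 * sin (π / 6 + x)) * (2 * sin (π / 6 + y)) * cos β) :
    π / 3 - x - y ≤ β ∧ β ≤ π / 3 + 2 * e - x - y := by
  have hpi := Real.pi_pos
  have hA : 0 < sin (π / 6 + x) := sin_pos_of_pos_of_lt_pi (by linarith) (by linarith)
  have hB : 0 < sin (π / 6 + y) := sin_pos_of_pos_of_lt_pi (by linarith) (by linarith)
  have hAB : 0 < 8 * sin (π / 6 + x) * sin (π / 6 + y) := by positivity
  have hL := sin_sq_sum_sub_one_le hx (hxe.trans he) hy (hye.trans he)
  have hU := le_sin_sq_sum_sub_sin_sq hx hxe hy hye he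
  constructor
  · by_contra! h
    have := cos_lt_cos_of_nonneg_of_le_pi hβ (by linarith) h
    nlinarith [mul_lt_mul_of_pos_left this hAB]
  · by_contra! h
    have := cos_lt_cos_of_nonneg_of_le_pi (by linarith) hβ' h
    nlinarith [mul_lt_mul_of_pos_left this hAB]

lemma triangle_cos_le {a b c l k : ℝ} (ha : 1 ≤ a) (hal : a ≤ l) (hb : 1 ≤ b) (hbl : b ≤ l)
    (hl : l ^ 2 ≤ 2) (hc : 1 ≤ c) (hcos : c ^ 2 = a ^ 2 + b ^ 2 - 2 * a * b * k) :
    2 * l ^ 2 * (1 - k) ≥ 1 := by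
  wlog hab : b ≤ a generalizing a b
  · exact this hb hbl ha hal (by linarith) (by linarith)
  have h1 : a * (a - b) ≤ 1 := by nlinarith
  have h2 : 0 ≤ (a - b) * (1 - a * (a - b)) := mul_nonneg (by linarith) (by linarith)
  have h3 : b ≤ a * (1 - (a - b) ^ 2) := by nlinarith
  have h4 : 1 - (a - b) ^ 2 ≤ 2 * a * b * (1 - k) := by nlinarith
  have h5 : b * 1 ≤ b * (2 * a ^ 2 * (1 - k)) := by nlinarith
  have h6 := le_of_mul_le_mul_left h5 (by linarith)
  have h7 : 0 ≤ 1 - k := by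
    by_contra! h
    nlinarith [mul_pos (show 0 < a ^ 2 by positivity) (neg_pos.2 h)]
  nlinarith [mul_le_mul_of_nonneg_right (show a ^ 2 ≤ l ^ 2 by nlinarith) h7]

lemma four_mul_sin_mul_sin_le_one {n : ℝ} (hn : 7 ≤ n) :
    4 * sin (π / 6 - π / (6 * n)) * sin (π / 6 + π / (6 * (n - 1))) ≤ 1 := by
  have hpi := Real.pi_gt_d2
  have hpi' := Real.pi_lt_d2
  set x := π / (6 * n) with hx
  set y := π / (6 * (n - 1)) with hy
  have hx0 : 0 < x := by positivity
  have hy0 : 0 < y := by apply div_pos <;> linarith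
  have hx1 : x ≤ 3.15 / 42 := by
    rw [hx]; apply div_le_div₀ <;> linarith
  have hy1 : y ≤ 3.15 / 36 := by
    rw [hy]; apply div_le_div₀ <;> linarith
  have hz : π * (y - x) = 6 * (x * y) := by
    have : n - 1 ≠ 0 := by linarith
    rw [hx, hy]; field_simp; ring
  have hz0 : 0 ≤ y - x := by nlinarith [mul_pos hx0 hy0]
  have hz1 : y - x ≤ 6 / 3.14 * (x * y) := by
    rw [div_mul_eq_mul_div, le_div_iff₀ (by norm_num)]; nlinarith
  have e1 : 4 * sin (π / 6 - x) * sin (π / 6 + y) =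
      2 * (cos (x + y) - cos (π / 3 + (y - x))) := by
    rw [show x + y = (π / 6 + y) - (π / 6 - x) by ring,
      show π / 3 + (y - x) = (π / 6 + y) + (π / 6 - x) by ring, cos_add, cos_sub]
    ring
  have e2 : cos (π / 3 + (y - x)) = cos (y - x) / 2 - √3 / 2 * sin (y - x) := by
    rw [cos_add, cos_pi_div_three, sin_pi_div_three]; ring
  have b1 : cos (x + y) ≤ 1 - (x + y) ^ 2 / 2 + (x + y) ^ 4 * (5 / 96) := by
    have := cos_bound (x := x + y) (abs_le.2 ⟨by linarith, by linarith⟩)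
    rw [abs_of_pos (show 0 < x + y by linarith)] at this
    linarith [(abs_le.1 this).2]
  have b2 : 1 - (y - x) ^ 2 / 2 ≤ cos (y - x) := one_sub_sq_div_two_le_cos
  have b3 : sin (y - x) ≤ y - x := sin_le hz0
  have b4 : √3 ≤ 1.74 := by rw [Real.sqrt_le_left (by norm_num)]; norm_num
  have b5 : √3 * sin (y - x) ≤ 1.74 * (y - x) := by
    have : 0 ≤ sin (y - x) := sin_nonneg_of_nonneg_of_le_pi hz0 (by linarith)
    exact mul_le_mul b4 b3 this (by norm_num)
  have b6 : (x + y) ^ 4 ≤ 0.04 * (x + y) ^ 2 := by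
    have : (x + y) ^ 2 ≤ 0.04 := by nlinarith
    nlinarith [sq_nonneg (x + y)]
  have b7 : (y - x) ^ 2 ≤ 0.1 * (y - x) := by nlinarith
  have b8 : 4 * (x * y) ≤ (x + y) ^ 2 := by nlinarith [sq_nonneg (x - y)]
  rw [e1, e2]
  have : 0 < x * y := by positivity
  nlinarith

lemma forall_of_forall_add_one {n : ℕ} [NeZero n] {P : ZMod n → Prop} (j₀ : ZMod n)
    (h₀ : P j₀) (h : ∀ j, P j → P (j + 1)) (j : ZMod n) : P j := by
  have key : ∀ k : ℕ, P (j₀ + k) := by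
    intro k
    induction k with
    | zero => simpa using h₀
    | succ k ih => simpa [add_assoc] using h _ ih
  simpa using key (j - j₀).val

/-- A cyclic sequence of signs which is not constant changes sign at least twice, and each sign
change lowers the sum by `e` from its largest possible value `2 * e * n`. -/
lemma sum_le_of_sign_changes {n : ℕ} [NeZero n] {σ : ZMod n → ℝ} {x : ZMod n → ℝ} {e : ℝ}
    (hσ : ∀ j, σ j = 1 ∨ σ j = -1) (hx : ∀ j, 0 ≤ x j) (hxe : ∀ j, x j ≤ e)
    {i₁ i₂ : ZMod n} (h₁ : σ i₁ = 1) (h₂ : σ i₂ = -1) :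
    ∑ j, (e + σ j * (e - x j - x (j - 1))) ≤ 2 * e * (n - 1) := by
  obtain ⟨j₁, hj₁, hj₁'⟩ : ∃ j, σ j = 1 ∧ σ (j + 1) = -1 := by
    by_contra! h
    have := forall_of_forall_add_one (P := fun j => σ j = 1) i₁ h₁
      (fun j hj => (hσ _).resolve_right (h j hj)) i₂
    linarith
  obtain ⟨j₂, hj₂, hj₂'⟩ : ∃ j, σ j = -1 ∧ σ (j + 1) = 1 := by
    by_contra! h
    have := forall_of_forall_add_one (P := fun j => σ j = -1) i₂ h₂
      (fun j hj => (hσ _).resolve_left (h j hj)) i₁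
    linarith
  have hne : j₁ ≠ j₂ := by rintro rfl; linarith
  have hshift : ∑ j, σ j * (e / 2 - x (j - 1)) = ∑ j, σ (j + 1) * (e / 2 - x j) := by
    rw [← Equiv.sum_comp (Equiv.addRight (1 : ZMod n))]
    simp
  have hsum : ∑ j, (e + σ j * (e - x j - x (j - 1))) =
      ∑ j, (e + (σ j + σ (j + 1)) * (e / 2 - x j)) := by
    have : ∀ j, e + σ j * (e - x j - x (j - 1)) =
      (e + σ j * (e / 2 - x j)) + σ j * (e / 2 - x (j - 1)) := fun j => by ring
    simp_rw [this]
    rw [Finset.sum_add_distrib, hshift, ← Finset.sum_add_distrib]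
    exact Finset.sum_congr rfl fun j _ => by ring
  rw [hsum]
  calc ∑ j, (e + (σ j + σ (j + 1)) * (e / 2 - x j))
      ≤ ∑ j, (2 * e - (if j = j₁ then e else 0) - (if j = j₂ then e else 0)) := by
        refine Finset.sum_le_sum fun j _ => ?_
        have a := hx j
        have b := hxe j
        by_cases h1 : j = j₁
        · subst h1; rw [hj₁, hj₁', if_pos rfl, if_neg hne]; linarith
        by_cases h2 : j = j₂
        · subst h2; rw [hj₂, hj₂', if_neg h1, if_pos rfl]; linarith
        rw [if_neg h1, if_neg h2]
        rcases hσ j with h | h <;> rcases hσ (j + 1) with h' | h' <;> rw [h, h'] <;> linarith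
    _ = 2 * e * (n - 1) := by
        simp [Finset.sum_sub_distrib, ZMod.card]; ring

lemma sum_signed_angles_ne_of_defect_one {n : ℕ} [NeZero n] {σ β x : ZMod n → ℝ} {e : ℝ}
    (hn : n % 6 = 1)
    (hσ : ∀ j, σ j = 1 ∨ σ j = -1) (hx : ∀ j, 0 ≤ x j) (hxe : ∀ j, x j ≤ e)
    (hlo : ∀ j, π / 3 - x j - x (j - 1) ≤ β j)
    (hhi : ∀ j, β j ≤ π / 3 + 2 * e - x j - x (j - 1))
    (hlo' : ∀ j, π / 3 * (1 - 1 / n) < β j)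
    (he : 2 * e * (n - 1) < π / 3) {d w : ℤ} (hd : ∑ j, σ j = d) (hdw : 6 * w - d = 1)
    (hsum : ∑ j, σ j * β j = 2 * π * w) : False := by
  have hn0 : (0 : ℝ) < n := by exact_mod_cast Nat.pos_of_ne_zero (NeZero.ne n)
  have hD : ∑ j, σ j * (β j - π / 3) = π / 3 := by
    simp_rw [mul_sub]
    rw [Finset.sum_sub_distrib, ← Finset.sum_mul, hsum, hd]
    have : (6 * w - d : ℝ) = 1 := by exact_mod_cast hdw
    linear_combination π / 3 * this
  by_cases hP : ∀ j, σ j = 1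
  · simp only [hP, Finset.sum_const, Finset.card_univ, ZMod.card, nsmul_eq_mul, mul_one] at hd
    have : (n : ℤ) = d := by exact_mod_cast hd
    omega
  by_cases hN : ∀ j, σ j = -1
  · have : ∑ j, σ j * (β j - π / 3) < ∑ _j : ZMod n, π / 3 * (1 / n) := by
      refine Finset.sum_lt_sum_of_nonempty Finset.univ_nonempty fun j _ => ?_
      rw [hN]; linarith [hlo' j]
    rw [hD, Finset.sum_const, Finset.card_univ, ZMod.card, nsmul_eq_mul] at this
    field_simp at this
    linarith
  push Not at hP hN
  obtain ⟨i₂, hi₂⟩ := hP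
  obtain ⟨i₁, hi₁⟩ := hN
  have h := sum_le_of_sign_changes hσ hx hxe ((hσ i₁).resolve_right hi₁)
    ((hσ i₂).resolve_left hi₂)
  have : ∑ j, σ j * (β j - π / 3) ≤ ∑ j, (e + σ j * (e - x j - x (j - 1))) := by
    refine Finset.sum_le_sum fun j _ => ?_
    rcases hσ j with h | h <;> rw [h]
    · linarith [hhi j]
    · linarith [hlo j]
  linarith

lemma sum_signed_angles_ne {n : ℕ} [NeZero n] {σ β x : ZMod n → ℝ} {e : ℝ}
    (hn7 : 7 ≤ n) (hn : n % 6 = 1)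
    (hσ : ∀ j, σ j = 1 ∨ σ j = -1) (hx : ∀ j, 0 ≤ x j) (hxe : ∀ j, x j ≤ e)
    (hlo : ∀ j, π / 3 - x j - x (j - 1) ≤ β j)
    (hhi : ∀ j, β j ≤ π / 3 + 2 * e - x j - x (j - 1))
    (hlo' : ∀ j, π / 3 * (1 - 1 / n) < β j)
    (he : 2 * e * (n - 1) < π / 3) (w : ℤ) : ∑ j, σ j * β j ≠ 2 * π * w := by
  intro hsum
  have hpi := Real.pi_pos
  have hn7' : (7 : ℝ) ≤ n := by exact_mod_cast hn7
  obtain ⟨m, hm⟩ : ∃ m : ℤ, ∑ j, σ j = n - 2 * m := by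
    refine ⟨∑ j, if σ j = 1 then 0 else 1, ?_⟩
    push_cast
    rw [Finset.mul_sum, eq_sub_iff_add_eq, ← Finset.sum_add_distrib]
    have : ∀ j, σ j + 2 * (if σ j = 1 then (0 : ℝ) else 1) = 1 := by
      intro j
      rcases hσ j with h | h <;> rw [h] <;> norm_num
    rw [Finset.sum_congr rfl fun j _ => this j]
    simp [ZMod.card]
  have hd : ∑ j, σ j = ((n - 2 * m : ℤ) : ℝ) := by rw [hm]; push_cast; ring
  generalize hdef : (n - 2 * m : ℤ) = d at hd
  have hD : ∑ j, σ j * (β j - π / 3) = π / 3 * (6 * w - d : ℤ) := by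
    simp_rw [mul_sub]
    rw [Finset.sum_sub_distrib, ← Finset.sum_mul, hsum, hd]
    push_cast; ring
  have hb : |∑ j, σ j * (β j - π / 3)| ≤ ∑ _j : ZMod n, 2 * e := by
    refine (Finset.abs_sum_le_sum_abs _ _).trans (Finset.sum_le_sum fun j _ => ?_)
    have h1 := hlo j
    have h2 := hhi j
    have h3 := hx j
    have h4 := hxe j
    have h5 := hx (j - 1)
    have h6 := hxe (j - 1)
    rcases hσ j with h | h <;> rw [h, abs_le] <;> constructor <;> linarith
  rw [Finset.sum_const, Finset.card_univ, ZMod.card, nsmul_eq_mul, hD, abs_mul,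
    abs_of_pos (by positivity : 0 < π / 3)] at hb
  have he' : (n : ℝ) * (2 * e) < π / 3 * 3 := by
    by_contra! h
    nlinarith
  have hlt : |((6 * w - d : ℤ) : ℝ)| < 3 := lt_of_mul_lt_mul_left (hb.trans_lt he') (by positivity)
  rw [← Int.cast_abs] at hlt
  have hlt' : |6 * w - d| < 3 := by exact_mod_cast hlt
  rw [abs_lt] at hlt'
  have : 6 * w - d = 1 ∨ 6 * (-w) - (-d) = 1 := by omega
  rcases this with h | h
  · exact sum_signed_angles_ne_of_defect_one hn hσ hx hxe hlo hhi hlo' he hd h hsum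
  · refine sum_signed_angles_ne_of_defect_one (σ := fun j => -σ j) hn (fun j => ?_) hx hxe hlo hhi hlo' he
      (d := -d) (w := -w) ?_ h ?_
    · rcases hσ j with h | h <;> rw [h] <;> norm_num
    · rw [Finset.sum_neg_distrib, hd]; push_cast; rfl
    · simp_rw [neg_mul]
      rw [Finset.sum_neg_distrib, hsum]; push_cast; ring

lemma exists_sum_arg_div_eq {n : ℕ} [NeZero n] {p : ZMod n → ℂ} (hp : ∀ j, p j ≠ 0) :
    ∃ w : ℤ, ∑ j, (p j / p (j - 1)).arg = 2 * π * w := by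
  have hshift : ∏ j, p (j - 1) = ∏ j, p j := Equiv.prod_comp (Equiv.subRight (1 : ZMod n)) p
  have hprod : ∏ j, (p j / p (j - 1)) = 1 := by
    rw [Finset.prod_div_distrib, hshift]
    exact div_self (Finset.prod_ne_zero_iff.2 fun j _ => hp j)
  have hexp : Complex.exp ((∑ j, (p j / p (j - 1)).arg : ℝ) * Complex.I) = 1 := by
    push_cast
    rw [Finset.sum_mul, Complex.exp_sum]
    have h1 : ∏ j, ((‖p j / p (j - 1)‖ : ℂ) *
        Complex.exp ((p j / p (j - 1)).arg * Complex.I)) = 1 := by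
      simp_rw [Complex.norm_mul_exp_arg_mul_I]; exact hprod
    rw [Finset.prod_mul_distrib] at h1
    have h2 : ∏ j, (‖p j / p (j - 1)‖ : ℂ) = 1 := by
      rw [← Complex.ofReal_prod, ← norm_prod, hprod]; simp
    rwa [h2, one_mul] at h1
  obtain ⟨w, hw⟩ := Complex.exp_eq_one_iff.1 hexp
  refine ⟨w, ?_⟩
  have : (((∑ j, (p j / p (j - 1)).arg : ℝ) : ℂ)) = ((2 * π * w : ℝ) : ℂ) := by
    apply mul_right_cancel₀ Complex.I_ne_zero
    rw [hw]; push_cast; ring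
  exact_mod_cast this

lemma norm_sub_sq_eq_arg_div {z w : ℂ} (hw : w ≠ 0) :
    ‖z - w‖ ^ 2 = ‖z‖ ^ 2 + ‖w‖ ^ 2 - 2 * ‖z‖ * ‖w‖ * cos |(z / w).arg| := by
  rw [cos_abs]
  have hw' : ‖w‖ ≠ 0 := by simpa using hw
  obtain ⟨u, rfl⟩ : ∃ u, z = u * w := ⟨z / w, by field_simp⟩
  rw [mul_div_cancel_right₀ u hw, show u * w - w = (u - 1) * w by ring, norm_mul, norm_mul]
  have h1 : ‖u‖ * cos u.arg = u.re := Complex.norm_mul_cos_arg u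
  have h2 : ‖u - 1‖ ^ 2 = ‖u‖ ^ 2 + 1 - 2 * u.re := by
    rw [← Complex.normSq_eq_norm_sq, ← Complex.normSq_eq_norm_sq, Complex.normSq_apply,
      Complex.normSq_apply]
    simp; ring
  linear_combination ‖w‖ ^ 2 * h2 + 2 * ‖w‖ ^ 2 * h1

lemma wheel_lower_bound {n : ℕ} (hn : 7 ≤ n) (hmod : n % 6 = 1) {l : ℝ} {p : ZMod n → ℂ}
    (hp : ∀ j : ZMod n,
      1 ≤ ‖p j‖ ∧ ‖p j‖ ≤ l ∧ 1 ≤ ‖p j - p (j - 1)‖ ∧ ‖p j - p (j - 1)‖ ≤ l) :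
    2 * sin (π / 6 + π / (6 * ((n : ℝ) - 1))) ≤ l := by
  by_contra! hl
  have : NeZero n := ⟨by omega⟩
  have hpi := Real.pi_pos
  have hn' : (7 : ℝ) ≤ n := by exact_mod_cast hn
  have hl1 : 1 ≤ l := (hp 0).1.trans (hp 0).2.1
  have hE : π / (6 * ((n : ℝ) - 1)) ≤ π / 36 := by
    apply div_le_div_of_nonneg_left <;> linarith
  have hE0 : 0 < π / (6 * ((n : ℝ) - 1)) := by apply div_pos <;> linarith
  set E := π / (6 * ((n : ℝ) - 1)) with hEdef
  have hl2 : l ^ 2 ≤ 2 := by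
    have h1 : sin (π / 6 + E) ≤ sin (π / 4) :=
      sin_le_sin_of_le_of_le_pi_div_two (by linarith) (by linarith) (by linarith)
    rw [sin_pi_div_four] at h1
    have h2 : √2 ^ 2 = 2 := Real.sq_sqrt (by norm_num)
    have h3 : l ≤ √2 := by linarith
    nlinarith
  have harc : ∀ a : ℝ, 1 ≤ a → a ≤ l → ∃ x, 0 ≤ x ∧ x < E ∧ a = 2 * sin (π / 6 + x) := by
    intro a ha hal
    have hs : sin (arcsin (a / 2)) = a / 2 := sin_arcsin (by linarith) (by nlinarith)
    refine ⟨arcsin (a / 2) - π / 6, ?_, ?_, ?_⟩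
    · rw [sub_nonneg, le_arcsin_iff_sin_le' ⟨by linarith, by linarith⟩, sin_pi_div_six]
      linarith
    · rw [sub_lt_iff_lt_add', arcsin_lt_iff_lt_sin' ⟨by linarith, by linarith⟩]
      linarith
    · rw [add_sub_cancel, hs]; ring
  obtain ⟨e, he0, heE, hel⟩ := harc l hl1 le_rfl
  choose x hx0 hxE hx using fun j => harc ‖p j‖ (hp j).1 (hp j).2.1
  have hxe : ∀ j, x j ≤ e := by
    intro j
    by_contra! h
    have := sin_lt_sin_of_lt_of_le_pi_div_two (x := π / 6 + e) (y := π / 6 + x j) (by linarith)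
      (by linarith [hxE j]) (by linarith)
    linarith [(hp j).2.1, hx j]
  have hp0 : ∀ j, p j ≠ 0 := fun j h => by
    have := (hp j).1
    rw [h, norm_zero] at this
    linarith
  obtain ⟨w, hw⟩ := exists_sum_arg_div_eq hp0
  set α : ZMod n → ℝ := fun j => (p j / p (j - 1)).arg with hα
  have hlaw : ∀ j, ‖p j - p (j - 1)‖ ^ 2 =
      ‖p j‖ ^ 2 + ‖p (j - 1)‖ ^ 2 - 2 * ‖p j‖ * ‖p (j - 1)‖ * cos |α j| :=
    fun j => norm_sub_sq_eq_arg_div (hp0 _)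
  have hb : ∀ j, π / 3 - x j - x (j - 1) ≤ |α j| ∧
      |α j| ≤ π / 3 + 2 * e - x j - x (j - 1) := by
    intro j
    have h := hlaw j
    rw [hx j, hx (j - 1)] at h
    exact triangle_angle_bounds (hx0 _) (hxe _) (hx0 _) (hxe _) (by linarith) (abs_nonneg _)
      (Complex.abs_arg_le_pi _) (hp j).2.2.1 (hel ▸ (hp j).2.2.2) h
  have hmin : ∀ j, π / 3 * (1 - 1 / n) < |α j| := by
    intro j
    by_contra! h
    have hn1 : (1 : ℝ) / n ≤ 1 := by rw [div_le_one] <;> linarith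
    have hn0 : (0 : ℝ) < 1 / n := by positivity
    have hc := cos_le_cos_of_nonneg_of_le_pi (abs_nonneg _)
      (by nlinarith) h
    have h1 := triangle_cos_le (hp j).1 (hp j).2.1 (hp (j - 1)).1 (hp (j - 1)).2.1 hl2
      (hp j).2.2.1 (hlaw j)
    have h2 := four_mul_sin_mul_sin_le_one hn'
    rw [show π / 3 * (1 - 1 / (n : ℝ)) = 2 * (π / 6 - π / (6 * n)) by field_simp; ring,
      cos_two_mul, cos_sq'] at hc
    have h3 : 0 < sin (π / 6 - π / (6 * n)) := by
      have : π / (6 * n) ≤ π / 42 := by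
        apply div_le_div_of_nonneg_left <;> linarith
      have : 0 < π / (6 * n) := by positivity
      exact sin_pos_of_pos_of_lt_pi (by linarith) (by linarith)
    have h4 : 2 * l * sin (π / 6 - π / (6 * n)) < 1 := by nlinarith
    have h5 : 0 < 2 * l * sin (π / 6 - π / (6 * n)) := by positivity
    have h6 : 2 * l ^ 2 * (1 - cos |α j|) ≤ (2 * l * sin (π / 6 - π / (6 * n))) ^ 2 := by
      nlinarith [mul_le_mul_of_nonneg_left hc (sq_nonneg l)]
    nlinarith
  refine sum_signed_angles_ne (σ := fun j => if 0 ≤ α j then 1 else -1) hn hmod ?_ hx0 hxe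
    (fun j => (hb j).1) (fun j => (hb j).2) hmin ?_ w ?_
  · intro j
    split_ifs <;> simp
  · have : 2 * E * (n - 1) = π / 3 := by
      have : (n : ℝ) - 1 ≠ 0 := by linarith
      rw [hEdef]; field_simp; ring
    nlinarith
  · rw [← hw]
    refine Finset.sum_congr rfl fun j _ => ?_
    split_ifs with h
    · rw [abs_of_nonneg h, one_mul]
    · rw [abs_of_neg (not_le.1 h), neg_one_mul, neg_neg]

lemma norm_exp_mul_I_sub_exp_mul_I (a b : ℝ) :
    ‖Complex.exp (a * Complex.I) - Complex.exp (b * Complex.I)‖ = 2 * |sin ((a - b) / 2)| := by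
  have : Complex.exp (a * Complex.I) - Complex.exp (b * Complex.I) =
      Complex.exp (b * Complex.I) * (Complex.exp (Complex.I * (a - b : ℝ)) - 1) := by
    rw [mul_sub, ← Complex.exp_add, mul_one]; congr 2; push_cast; ring
  rw [this, norm_mul, Complex.norm_exp_ofReal_mul_I, one_mul, Complex.norm_exp_I_mul_ofReal_sub_one,
    norm_mul, Real.norm_eq_abs, Real.norm_eq_abs]
  norm_num

lemma wheel_attained {n : ℕ} (hn : 7 ≤ n) (hmod : n % 6 = 1) :
    ∃ p : ZMod n → ℂ, ∀ j : ZMod n, 1 ≤ ‖p j‖ ∧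
      ‖p j‖ ≤ 2 * sin (π / 6 + π / (6 * ((n : ℝ) - 1))) ∧ 1 ≤ ‖p j - p (j - 1)‖ ∧
      ‖p j - p (j - 1)‖ ≤ 2 * sin (π / 6 + π / (6 * ((n : ℝ) - 1))) := by
  have : NeZero n := ⟨by omega⟩
  have hpi := Real.pi_pos
  have hn' : (7 : ℝ) ≤ n := by exact_mod_cast hn
  have hE : π / (6 * ((n : ℝ) - 1)) ≤ π / 36 := by
    apply div_le_div_of_nonneg_left <;> linarith
  have hE0 : 0 < π / (6 * ((n : ℝ) - 1)) := by apply div_pos <;> linarith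
  set E := π / (6 * ((n : ℝ) - 1)) with hEdef
  have hEn : E * (n - 1) = π / 6 := by
    have : (n : ℝ) - 1 ≠ 0 := by linarith
    rw [hEdef]; field_simp
  have hone : 1 ≤ 2 * sin (π / 6 + E) := by
    have : sin (π / 6) ≤ sin (π / 6 + E) :=
      sin_le_sin_of_le_of_le_pi_div_two (by linarith) (by linarith) (by linarith)
    rw [sin_pi_div_six] at this
    linarith
  refine ⟨fun j => Complex.exp ((j.val * (2 * (π / 6 + E)) : ℝ) * Complex.I), fun j => ?_⟩
  have hnorm : ‖Complex.exp ((j.val * (2 * (π / 6 + E)) : ℝ) * Complex.I)‖ = 1 :=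
    Complex.norm_exp_ofReal_mul_I _
  suffices h : |sin ((j.val * (2 * (π / 6 + E)) - (j - 1).val * (2 * (π / 6 + E))) / 2)| = 1 / 2 ∨
      |sin ((j.val * (2 * (π / 6 + E)) - (j - 1).val * (2 * (π / 6 + E))) / 2)| =
        sin (π / 6 + E) by
    rw [hnorm, norm_exp_mul_I_sub_exp_mul_I]
    refine ⟨le_rfl, hone, ?_⟩
    rcases h with h | h <;> rw [h] <;> constructor <;> linarith
  by_cases hj : j = 0
  · left
    subst hj
    have hval : ((0 - 1 : ZMod n).val : ℝ) = n - 1 := by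
      obtain ⟨m, rfl⟩ : ∃ m, n = m + 1 := ⟨n - 1, by omega⟩
      rw [zero_sub, ZMod.val_neg_one]; push_cast; ring
    obtain ⟨k, hk⟩ : ∃ k, n = 6 * k + 1 := ⟨n / 6, by omega⟩
    rw [hval, ZMod.val_zero]
    have : (((0 : ℕ) : ℝ) * (2 * (π / 6 + E)) - (n - 1) * (2 * (π / 6 + E))) / 2 =
        -(π / 6 + k * π) := by
      have : (n : ℝ) = 6 * k + 1 := by exact_mod_cast hk
      push_cast
      linear_combination (-1) * hEn - π / 6 * this
    rw [this, sin_neg, abs_neg, sin_add_nat_mul_pi, abs_mul, abs_pow, sin_pi_div_six]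
    norm_num
  · right
    have hval : ((j - 1).val : ℝ) = j.val - 1 := by
      have h1 : 1 ≤ j.val := Nat.one_le_iff_ne_zero.2 ((ZMod.val_ne_zero j).2 hj)
      have : Fact (1 < n) := ⟨by omega⟩
      rw [ZMod.val_sub (by rwa [ZMod.val_one]), ZMod.val_one]
      push_cast [h1]; ring
    rw [hval, show ((j.val : ℝ) * (2 * (π / 6 + E)) - (j.val - 1) * (2 * (π / 6 + E))) / 2 =
      π / 6 + E by ring]
    exact abs_of_nonneg (by linarith)

theorem wheel_mod_one_least (n : ℕ) (hn : 7 ≤ n) (hmod : n % 6 = 1) :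
    IsLeast {l : ℝ | ∃ p : ZMod n → ℂ, ∀ j : ZMod n,
        1 ≤ ‖p j‖ ∧ ‖p j‖ ≤ l ∧ 1 ≤ ‖p j - p (j - 1)‖ ∧ ‖p j - p (j - 1)‖ ≤ l}
      (2 * Real.sin (Real.pi / 6 * ((n : ℝ) / ((n : ℝ) - 1)))) := by
  have hn' : (7 : ℝ) ≤ n := by exact_mod_cast hn
  have hne : (n : ℝ) - 1 ≠ 0 := by linarith
  rw [show π / 6 * ((n : ℝ) / ((n : ℝ) - 1)) = π / 6 + π / (6 * ((n : ℝ) - 1)) by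
    field_simp; ring]
  exact ⟨wheel_attained hn hmod, fun _ ⟨_, hp⟩ => wheel_lower_bound hn hmod hp⟩
end

section
/- Let n ≥ 5 be an integer with n ≡ 5 (mod 6) and define p : ZMod n → ℂ by p j = exp(i·j·(π/3)·((n+1)/n)) (where j is represented by an integer 0 ≤ j ≤ n-1). Then for every j ∈ ZMod n one has ‖p j‖ = 1 and ‖p j - p (j-1)‖ = 2·sin((π/6)·((n+1)/n)); in particular 1 ≤ ‖p j - p (j-1)‖ ≤ 2·sin((π/6)·((n+1)/n)). (The points form a regular star polygon inscribed in the unit circle.) -/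
open Real Complex

theorem pow_val_eq_pow_val_sub_one_mul {M : Type*} [Monoid M] {n : ℕ} [NeZero n] {ζ : M}
    (hζ : ζ ^ n = 1) (j : ZMod n) : ζ ^ j.val = ζ ^ (j - 1).val * ζ := by
  conv_lhs => rw [← sub_add_cancel j 1]
  rw [ZMod.val_add, ← pow_eq_pow_mod _ hζ, pow_add, ZMod.val_one_eq_one_mod,
    ← pow_eq_pow_mod _ hζ, pow_one]

theorem one_half_le_sin_pi_div_six_mul {x : ℝ} (h1 : 1 ≤ x) (h2 : x ≤ 3) :
    1 / 2 ≤ Real.sin (Real.pi / 6 * x) := by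
  have hpi := Real.pi_pos
  rw [← Real.sin_pi_div_six]
  apply Real.sin_le_sin_of_le_of_le_pi_div_two <;> nlinarith

theorem wheel_mod_five_star_polygon (n : ℕ) (hn : 5 ≤ n) (hmod : n % 6 = 5)
    (p : ZMod n → ℂ)
    (hp : ∀ j : ZMod n, p j =
      Complex.exp (Complex.I * (j.val : ℂ) *
        ((Real.pi : ℂ) / 3 * (((n : ℂ) + 1) / (n : ℂ))))) :
    ∀ j : ZMod n,
      ‖p j‖ = 1 ∧
      ‖p j - p (j - 1)‖ = 2 * Real.sin (Real.pi / 6 * (((n : ℝ) + 1) / (n : ℝ))) ∧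
      1 ≤ ‖p j - p (j - 1)‖ ∧
      ‖p j - p (j - 1)‖ ≤ 2 * Real.sin (Real.pi / 6 * (((n : ℝ) + 1) / (n : ℝ))) := by
  intro j
  have : NeZero n := ⟨by omega⟩
  have hn5 : (5 : ℝ) ≤ n := by exact_mod_cast hn
  set θ : ℝ := Real.pi / 3 * (((n : ℝ) + 1) / n) with hθ
  set ζ : ℂ := Complex.exp (Complex.I * θ) with hζ
  have hpow (i : ZMod n) : p i = ζ ^ i.val := by
    rw [hp, hζ, ← Complex.exp_nat_mul, hθ]
    push_cast
    ring_nf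
  have hζn : ζ ^ n = 1 := by
    obtain ⟨k, hk⟩ : ∃ k, n + 1 = 6 * k := ⟨(n + 1) / 6, by omega⟩
    have hk' : (n : ℂ) + 1 = 6 * k := by exact_mod_cast hk
    have hn0 : (n : ℂ) ≠ 0 := NeZero.ne _
    rw [hζ, ← Complex.exp_nat_mul, Complex.exp_eq_one_iff]
    refine ⟨k, ?_⟩
    rw [hθ]
    push_cast
    rw [hk']
    field_simp
    ring
  have hnorm : ‖ζ‖ = 1 := Complex.norm_exp_I_mul_ofReal θ
  have hsin : 1 / 2 ≤ Real.sin (Real.pi / 6 * (((n : ℝ) + 1) / n)) := by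
    apply one_half_le_sin_pi_div_six_mul
    · rw [le_div_iff₀ (by linarith)]; linarith
    · rw [div_le_iff₀ (by linarith)]; linarith
  have hdist : ‖p j - p (j - 1)‖ = 2 * Real.sin (Real.pi / 6 * (((n : ℝ) + 1) / n)) := by
    rw [hpow, hpow, pow_val_eq_pow_val_sub_one_mul hζn, ← mul_sub_one, norm_mul, norm_pow,
      hnorm, one_pow, one_mul, hζ, Complex.norm_exp_I_mul_ofReal_sub_one,
      show θ / 2 = Real.pi / 6 * (((n : ℝ) + 1) / n) by rw [hθ]; ring,
      Real.norm_of_nonneg (by linarith)]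
  refine ⟨by rw [hpow, norm_pow, hnorm, one_pow], hdist, ?_, hdist.le⟩
  linarith
end

section
/- Let n ≥ 7 be an integer with n ≡ 1 (mod 6) and define p : ZMod n → ℂ by p 0 = exp(i·π/3) and p (j+1) = exp(i·j·(π/3)·(n/(n-1))) for 0 ≤ j ≤ n-2. Then for every j ∈ ZMod n one has ‖p j‖ = 1 and 1 ≤ ‖p j - p (j-1)‖ ≤ 2·sin((π/6)·(n/(n-1))). -/
open Real Complex

theorem norm_exp_I_mul_natCast_succ_sub (k : ℕ) (θ : ℝ) :
    ‖Complex.exp (Complex.I * ((k + 1 : ℕ) : ℂ) * θ) - Complex.exp (Complex.I * (k : ℂ) * θ)‖ =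
      |2 * Real.sin (θ / 2)| := by
  have h : Complex.exp (Complex.I * ((k + 1 : ℕ) : ℂ) * θ) - Complex.exp (Complex.I * (k : ℂ) * θ)
      = Complex.exp (Complex.I * ((k * θ : ℝ) : ℂ)) * (Complex.exp (Complex.I * θ) - 1) := by
    rw [mul_sub, ← Complex.exp_add]
    push_cast
    ring_nf
  rw [h, norm_mul, Complex.norm_exp_I_mul_ofReal, one_mul, Complex.norm_exp_I_mul_ofReal_sub_one,
    Real.norm_eq_abs]

theorem norm_one_sub_exp_I_mul_pi_div_three :
    ‖1 - Complex.exp (Complex.I * ((Real.pi : ℂ) / 3))‖ = 1 := by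
  have h : (Real.pi : ℂ) / 3 = ((Real.pi / 3 : ℝ) : ℂ) := by push_cast; rfl
  rw [norm_sub_rev, h, Complex.norm_exp_I_mul_ofReal_sub_one,
    show Real.pi / 3 / 2 = Real.pi / 6 by ring, Real.sin_pi_div_six]
  norm_num

theorem one_le_two_mul_sin_of_mem_Icc {x : ℝ} (h₁ : Real.pi / 6 ≤ x) (h₂ : x ≤ Real.pi / 2) :
    1 ≤ 2 * Real.sin x := by
  have h := Real.sin_le_sin_of_le_of_le_pi_div_two (by linarith [Real.pi_pos]) h₂ h₁
  rw [Real.sin_pi_div_six] at h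
  linarith

theorem wheel_mod_one_flow (n : ℕ) (hn : 7 ≤ n) (hmod : n % 6 = 1)
    (p : ZMod n → ℂ)
    (hp0 : p 0 = Complex.exp (Complex.I * ((Real.pi : ℂ) / 3)))
    (hp : ∀ j : ℕ, j ≤ n - 2 → p ((j : ZMod n) + 1) =
      Complex.exp (Complex.I * (j : ℂ) *
        ((Real.pi : ℂ) / 3 * ((n : ℂ) / ((n : ℂ) - 1))))) :
    ∀ j : ZMod n,
      ‖p j‖ = 1 ∧
      1 ≤ ‖p j - p (j - 1)‖ ∧
      ‖p j - p (j - 1)‖ ≤ 2 * Real.sin (Real.pi / 6 * ((n : ℝ) / ((n : ℝ) - 1))) := by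
  have hn' : (7 : ℝ) ≤ n := by exact_mod_cast hn
  have hq₁ : 1 ≤ (n : ℝ) / ((n : ℝ) - 1) := by rw [le_div_iff₀ (by linarith)]; linarith
  have hq₂ : (n : ℝ) / ((n : ℝ) - 1) ≤ 3 := by rw [div_le_iff₀ (by linarith)]; linarith
  set θ : ℝ := Real.pi / 3 * ((n : ℝ) / ((n : ℝ) - 1)) with hθ
  have hθ2 : Real.pi / 6 * ((n : ℝ) / ((n : ℝ) - 1)) = θ / 2 := by rw [hθ]; ring
  have hθC : (Real.pi : ℂ) / 3 * ((n : ℂ) / ((n : ℂ) - 1)) = θ := by rw [hθ]; push_cast; rfl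
  rw [hθC] at hp
  rw [hθ2]
  have hsin : 1 ≤ 2 * Real.sin (θ / 2) :=
    one_le_two_mul_sin_of_mem_Icc (by rw [← hθ2]; nlinarith [Real.pi_pos])
      (by rw [← hθ2]; nlinarith [Real.pi_pos])
  have hall : ∀ m : ℕ, m < n → p ((m : ZMod n) + 1) = Complex.exp (Complex.I * (m : ℂ) * θ) := by
    intro m hm
    rcases Nat.lt_or_ge (n - 2) m with h | h
    · obtain ⟨k, hk⟩ : ∃ k, m = 6 * k := ⟨n / 6, by omega⟩
      have hmn : n = m + 1 := by omega
      have hz : (m : ZMod n) + 1 = 0 := by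
        have := ZMod.natCast_self n
        rwa [congrArg (Nat.cast : ℕ → ZMod n) hmn, Nat.cast_succ] at this
      have hm0 : (m : ℝ) ≠ 0 := by
        have : m ≠ 0 := by omega
        exact_mod_cast this
      have hmθ : (m : ℝ) * θ = Real.pi / 3 + k * (2 * Real.pi) := by
        have hnr : (n : ℝ) = m + 1 := by exact_mod_cast hmn
        have hkr : (m : ℝ) = 6 * k := by exact_mod_cast hk
        have : (m : ℝ) * θ = Real.pi / 3 * (m + 1) := by
          rw [hθ, hnr, add_sub_cancel_right]
          field_simp
        rw [this, hkr]
        ring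
      have hmθC : (m : ℂ) * θ = Real.pi / 3 + k * (2 * Real.pi) := by exact_mod_cast hmθ
      rw [hz, hp0, mul_assoc, hmθC, mul_add, Complex.exp_add,
        show Complex.I * ((k : ℂ) * (2 * Real.pi)) = k * (2 * Real.pi * Complex.I) by ring,
        Complex.exp_nat_mul_two_pi_mul_I, mul_one]
    · exact hp m h
  have : NeZero n := ⟨by omega⟩
  intro j
  obtain ⟨m, hm, rfl⟩ : ∃ m : ℕ, m < n ∧ j = (m : ZMod n) + 1 :=
    ⟨(j - 1).val, ZMod.val_lt _, by rw [ZMod.natCast_zmod_val]; ring⟩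
  refine ⟨?_, ?_⟩
  · rw [hall m hm, mul_assoc, ← Complex.ofReal_natCast, ← Complex.ofReal_mul,
      Complex.norm_exp_I_mul_ofReal]
  · rw [add_sub_cancel_right]
    cases m with
    | zero =>
      rw [hall 0 hm, Nat.cast_zero, Nat.cast_zero, hp0, mul_zero, zero_mul, Complex.exp_zero,
        norm_one_sub_exp_I_mul_pi_div_three]
      exact ⟨le_rfl, hsin⟩
    | succ k =>
      rw [hall (k + 1) hm, Nat.cast_succ (R := ZMod n), hall k (by omega),
        norm_exp_I_mul_natCast_succ_sub, abs_of_nonneg (by linarith)]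
      exact ⟨hsin, le_rfl⟩
end

section
/- Let n ≥ 9 be an integer with n ≡ 3 (mod 6) and define p : ZMod n → ℂ by p 0 = exp(2i·(π/6)·((2n-3)/(n-1))), p 1 = 2·sin((π/6)·(n/(n-1)))·exp(i·(π/6)·((2n-3)/(n-1))), and p (j+2) = exp(i·j·(π/3)·(n/(n-1))) for 0 ≤ j ≤ n-3. Then for every j ∈ ZMod n one has 1 ≤ ‖p j‖ ≤ 2·sin((π/6)·(n/(n-1))) and 1 ≤ ‖p j - p (j-1)‖ ≤ 2·sin((π/6)·(n/(n-1))). -/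
open Real Complex

theorem norm_rotate_sub_self {z w : ℂ} (hz : ‖z‖ = 1) {a : ℝ} (ha : 0 ≤ Real.sin a)
    (hw : w = z * Complex.exp (Complex.I * ((2 * a : ℝ) : ℂ))) : ‖w - z‖ = 2 * Real.sin a := by
  have h : w - z = z * (Complex.exp (Complex.I * ((2 * a : ℝ) : ℂ)) - 1) := by rw [hw]; ring
  rw [h, norm_mul, hz, one_mul, Complex.norm_exp_I_mul_ofReal_sub_one,
    mul_div_cancel_left₀ a two_ne_zero, Real.norm_of_nonneg (by positivity)]

theorem two_cos_mul_exp_I (b : ℝ) :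
    ((2 * Real.cos b : ℝ) : ℂ) * Complex.exp (Complex.I * b) =
      1 + Complex.exp (2 * Complex.I * b) := by
  have h : Complex.exp (-(b : ℂ) * Complex.I) * Complex.exp (Complex.I * b) = 1 := by
    rw [← Complex.exp_add, show -(b : ℂ) * Complex.I + Complex.I * b = 0 by ring, Complex.exp_zero]
  have h' : Complex.exp (2 * Complex.I * b) =
      Complex.exp (b * Complex.I) * Complex.exp (Complex.I * b) := by
    rw [← Complex.exp_add]; ring_nf
  push_cast
  rw [Complex.two_cos, add_mul, h, h', add_comm]

theorem wheel_mod_three_flow (n : ℕ) (hn : 9 ≤ n) (hmod : n % 6 = 3)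
    (p : ZMod n → ℂ)
    (hp0 : p 0 = Complex.exp (2 * Complex.I *
      ((Real.pi : ℂ) / 6 * ((2 * (n : ℂ) - 3) / ((n : ℂ) - 1)))))
    (hp1 : p 1 = (2 * Real.sin (Real.pi / 6 * ((n : ℝ) / ((n : ℝ) - 1))) : ℝ) *
      Complex.exp (Complex.I *
        ((Real.pi : ℂ) / 6 * ((2 * (n : ℂ) - 3) / ((n : ℂ) - 1)))))
    (hp : ∀ j : ℕ, j ≤ n - 3 → p ((j : ZMod n) + 2) =
      Complex.exp (Complex.I * (j : ℂ) *
        ((Real.pi : ℂ) / 3 * ((n : ℂ) / ((n : ℂ) - 1))))) :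
    ∀ j : ZMod n,
      1 ≤ ‖p j‖ ∧ ‖p j‖ ≤ 2 * Real.sin (Real.pi / 6 * ((n : ℝ) / ((n : ℝ) - 1))) ∧
      1 ≤ ‖p j - p (j - 1)‖ ∧
      ‖p j - p (j - 1)‖ ≤ 2 * Real.sin (Real.pi / 6 * ((n : ℝ) / ((n : ℝ) - 1))) := by
  have hn1 : (0 : ℝ) < (n : ℝ) - 1 := by
    have : (9 : ℝ) ≤ n := by exact_mod_cast hn
    linarith
  have hn1' : (n : ℂ) - 1 ≠ 0 := by exact_mod_cast hn1.ne'
  set a : ℝ := Real.pi / 6 * ((n : ℝ) / ((n : ℝ) - 1)) with ha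
  obtain ⟨b, hb⟩ : ∃ b : ℝ, b = Real.pi / 6 * ((2 * (n : ℝ) - 3) / ((n : ℝ) - 1)) := ⟨_, rfl⟩
  have hbC : (Real.pi : ℂ) / 6 * ((2 * (n : ℂ) - 3) / ((n : ℂ) - 1)) = (b : ℂ) := by
    rw [hb]; push_cast; ring
  have haC : (Real.pi : ℂ) / 3 * ((n : ℂ) / ((n : ℂ) - 1)) = ((2 * a : ℝ) : ℂ) := by
    rw [ha]; push_cast; ring
  have hcos : Real.cos b = Real.sin a := by
    rw [← Real.cos_pi_div_two_sub]
    congr 1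
    rw [ha, hb]
    field_simp
    ring
  have hlam : 1 ≤ 2 * Real.sin a := by
    have hq : 1 ≤ (n : ℝ) / ((n : ℝ) - 1) := by rw [le_div_iff₀ hn1]; linarith
    have hq' : (n : ℝ) / ((n : ℝ) - 1) ≤ 3 := by
      rw [div_le_iff₀ hn1]
      have : (9 : ℝ) ≤ n := by exact_mod_cast hn
      linarith
    have h := Real.sin_le_sin_of_le_of_le_pi_div_two (x := Real.pi / 6) (y := a)
      (by linarith [Real.pi_pos]) (by nlinarith [Real.pi_pos]) (by nlinarith [Real.pi_pos])
    rw [Real.sin_pi_div_six] at h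
    linarith
  have hsin : 0 ≤ Real.sin a := by linarith
  rw [hbC] at hp0 hp1
  rw [haC] at hp
  have hp1' : p 1 = 1 + p 0 := by rw [hp1, hp0, ← hcos, two_cos_mul_exp_I]
  have hp2 : p 2 = 1 := by simpa using hp 0 (Nat.zero_le _)
  have hnorm0 : ‖p 0‖ = 1 := by
    rw [hp0, show 2 * Complex.I * (b : ℂ) = ((2 * b : ℝ) : ℂ) * Complex.I by push_cast; ring,
      Complex.norm_exp_ofReal_mul_I]
  have hnorm (j : ℕ) (hj : j ≤ n - 3) : ‖p ((j : ZMod n) + 2)‖ = 1 := by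
    rw [hp j hj, show Complex.I * (j : ℂ) * ((2 * a : ℝ) : ℂ) =
      ((j * (2 * a) : ℝ) : ℂ) * Complex.I by push_cast; ring, Complex.norm_exp_ofReal_mul_I]
  have hlast : p 0 = p (((n - 3 : ℕ) : ZMod n) + 2) *
      Complex.exp (Complex.I * ((2 * a : ℝ) : ℂ)) := by
    rw [hp _ le_rfl, hp0, ← Complex.exp_add, Complex.exp_eq_exp_iff_exists_int]
    obtain ⟨m, hm⟩ : ∃ m, n = 6 * m + 3 := ⟨n / 6, by omega⟩
    refine ⟨-m, ?_⟩
    have h3 : n - 3 = 6 * m := by omega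
    have hnm : (n : ℂ) = 6 * m + 3 := by rw [hm]; push_cast; ring
    rw [h3, ← haC, ← hbC]
    push_cast
    field_simp
    rw [hnm]
    ring
  have : NeZero n := ⟨by omega⟩
  intro j
  obtain ⟨k, hk, rfl⟩ : ∃ k : ℕ, k < n ∧ (k : ZMod n) = j :=
    ⟨j.val, ZMod.val_lt j, ZMod.natCast_zmod_val j⟩
  match k, hk with
  | 0, _ =>
    have hpred : ((0 : ℕ) : ZMod n) - 1 = ((n - 3 : ℕ) : ZMod n) + 2 := by
      rw [Nat.cast_sub (by omega), ZMod.natCast_self]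
      push_cast
      ring
    have hd := norm_rotate_sub_self (hnorm _ le_rfl) hsin hlast
    rw [hpred, Nat.cast_zero, hnorm0, hd]
    exact ⟨le_rfl, hlam, hlam, le_rfl⟩
  | 1, _ =>
    have hnorm1 : ‖p 1‖ = 2 * Real.sin a := by
      rw [hp1, norm_mul, mul_comm Complex.I, Complex.norm_exp_ofReal_mul_I, mul_one,
        Complex.norm_real, Real.norm_of_nonneg (by positivity)]
    rw [Nat.cast_one, sub_self, hnorm1, hp1', add_sub_cancel_right, norm_one]
    exact ⟨hlam, le_rfl, le_rfl, hlam⟩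
  | 2, _ =>
    rw [Nat.cast_ofNat, show (2 : ZMod n) - 1 = 1 by ring, hp1', hp2, sub_add_cancel_left,
      norm_neg, hnorm0, norm_one]
    exact ⟨le_rfl, hlam, le_rfl, hlam⟩
  | i + 3, hk =>
    have hcast : ((i + 3 : ℕ) : ZMod n) = ((i + 1 : ℕ) : ZMod n) + 2 := by push_cast; ring
    have hpred : ((i + 1 : ℕ) : ZMod n) + 2 - 1 = (i : ZMod n) + 2 := by push_cast; ring
    have hstep : p (((i + 1 : ℕ) : ZMod n) + 2) =
        p ((i : ZMod n) + 2) * Complex.exp (Complex.I * ((2 * a : ℝ) : ℂ)) := by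
      rw [hp _ (by omega), hp _ (by omega), ← Complex.exp_add]
      congr 1
      push_cast
      ring
    have hd := norm_rotate_sub_self (hnorm i (by omega)) hsin hstep
    rw [hcast, hpred, hnorm _ (by omega), hd]
    exact ⟨le_rfl, hlam, hlam, le_rfl⟩
end

section
/- For every integer n ≥ 3 there exists p : ZMod n → ℂ such that for every j ∈ ZMod n both ‖p j‖ and ‖p j - p (j-1)‖ lie in the interval [1, √2]. (Equivalently, φ_ℂ(W_n) ≤ 1 + √2 for every n ≥ 3.) -/
open Real

/-- Every cycle of length at least `2` is properly `3`-colourable. -/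
theorem ZMod.exists_fin_three_ne_sub_one (n : ℕ) (hn : 2 ≤ n) :
    ∃ c : ZMod n → Fin 3, ∀ j, c j ≠ c (j - 1) := by
  obtain ⟨m, rfl⟩ : ∃ m, n = m + 2 := ⟨n - 2, by omega⟩
  let C := SimpleGraph.cycleGraph.tricoloring (m + 2) (by omega)
  refine ⟨fun j => C j, fun j => C.valid ?_⟩
  exact SimpleGraph.cycleGraph_adj.mpr (Or.inl (sub_sub_cancel j 1))

/-- Three vertices of the unit square whose fourth vertex is the origin. -/
noncomputable def squareVertex : Fin 3 → ℂ := ![1, Complex.I, 1 + Complex.I]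

theorem norm_squareVertex_mem (a : Fin 3) :
    1 ≤ ‖squareVertex a‖ ∧ ‖squareVertex a‖ ≤ √2 := by
  rw [Complex.norm_eq_sqrt_sq_add_sq, Real.one_le_sqrt]
  fin_cases a <;> norm_num [squareVertex]

theorem norm_squareVertex_sub_mem {a b : Fin 3} (hab : a ≠ b) :
    1 ≤ ‖squareVertex a - squareVertex b‖ ∧ ‖squareVertex a - squareVertex b‖ ≤ √2 := by
  rw [Complex.norm_eq_sqrt_sq_add_sq, Real.one_le_sqrt]
  revert hab
  fin_cases a <;> fin_cases b <;> norm_num [squareVertex]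

theorem wheel_sqrt_two (n : ℕ) (hn : 3 ≤ n) :
    ∃ p : ZMod n → ℂ, ∀ j : ZMod n,
      1 ≤ ‖p j‖ ∧ ‖p j‖ ≤ Real.sqrt 2 ∧
      1 ≤ ‖p j - p (j - 1)‖ ∧ ‖p j - p (j - 1)‖ ≤ Real.sqrt 2 := by
  obtain ⟨c, hc⟩ := ZMod.exists_fin_three_ne_sub_one n (by omega)
  exact ⟨fun j => squareVertex (c j), fun j =>
    ⟨(norm_squareVertex_mem (c j)).1, (norm_squareVertex_mem (c j)).2,
      norm_squareVertex_sub_mem (hc j)⟩⟩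
end
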